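/- Let U be a nonzero polynomial in ℚ[X] and let R be the localization of ℚ[X] at the multiplicative set generated by X·U (so R is a model of the ring ℚ[A^{±1}][U^{-1}] appearing in the paper). Let M be a finitely generated R-module. For every ζ ∈ ℂ with ζ ≠ 0 and U(ζ) ≠ 0, evaluation of polynomials at ζ extends uniquely to a ring homomorphism R → ℂ, making ℂ an R-algebra; write d(ζ) for the dimension of ℂ ⊗_R M as a ℂ-vector space. Then the set of ζ ∈ ℂ with ζ ≠ 0, U(ζ) ≠ 0 and d(ζ) ≠ dim_{Frac(R)}(Frac(R) ⊗_R M) is finite. -/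

import Mathlib

open Polynomial TensorProduct

/-- The ring `ℚ[A^{±1}][U^{-1}]`: the localization of `ℚ[X]` at the multiplicative set
generated by `X * U`. -/
abbrev LocRing (U : Polynomial ℚ) : Type :=
  Localization (Submonoid.powers (Polynomial.X * U))

/-- A finite module over a Noetherian domain has constant fiber rank, equal to its generic rank,
over some nonempty basic open subset of the spectrum. -/
theorem exists_finrank_tensorProduct_eq_generic (R : Type*) [CommRing R] [IsDomain R]
    [IsNoetherianRing R] (M : Type*) [AddCommGroup M] [Module R M] [Module.Finite R M]
    (K : Type*) [Field K] :
    ∃ r : R, r ≠ 0 ∧ ∀ [Algebra R K], algebraMap R K r ≠ 0 →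
      Module.finrank K (K ⊗[R] M) =
        Module.finrank (FractionRing R) (FractionRing R ⊗[R] M) := by
  have : Module.FinitePresentation R M := Module.finitePresentation_of_finite R M
  obtain ⟨r, hr, _, hrank⟩ := Module.FinitePresentation.exists_free_localizedModule_powers
    (nonZeroDivisors R) (TensorProduct.mk R (FractionRing R) M 1) (FractionRing R)
  refine ⟨r, nonZeroDivisors.ne_zero hr, fun {_} hrK ↦ ?_⟩
  let L := Localization (Submonoid.powers r)
  let ψ : L →+* K := IsLocalization.Away.lift r hrK.isUnit
  let _ : Algebra L K := ψ.toAlgebra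
  have : IsScalarTower R L K :=
    .of_algebraMap_eq fun x ↦ (IsLocalization.Away.lift_eq r hrK.isUnit x).symm
  have : Nontrivial L := ψ.domain_nontrivial
  have e : K ⊗[L] LocalizedModule.Away r M ≃ₗ[K] K ⊗[R] M :=
    (LocalizedModule.equivTensorProduct (.powers r) M).baseChange L K _ _ ≪≫ₗ
      AlgebraTensorModule.cancelBaseChange R L K K M
  rw [← hrank, ← e.finrank_eq, Module.finrank_baseChange]

/-- For a finitely generated module `M` over `R = ℚ[X]` localized at the powers of
`X * U` (with `U ≠ 0`), for all but finitely many `ζ ∈ ℂ` with `ζ ≠ 0` and `U(ζ) ≠ 0`,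
the fiber dimension `dim_ℂ (ℂ ⊗[R] M)` — where `ℂ` is an `R`-algebra via the (unique)
ring homomorphism `R → ℂ` extending evaluation of polynomials at `ζ` — equals the
generic rank `dim_{Frac R} (Frac R ⊗[R] M)`. -/
theorem stmt_0 (U : Polynomial ℚ) (hU : U ≠ 0)
    (M : Type*) [AddCommGroup M] [Module (LocRing U) M]
    [Module.Finite (LocRing U) M] :
    {ζ : ℂ | ζ ≠ 0 ∧ Polynomial.aeval ζ U ≠ 0 ∧
      ∀ φ : LocRing U →+* ℂ,
        (∀ q : Polynomial ℚ,
            φ (algebraMap (Polynomial ℚ) (LocRing U) q) = Polynomial.aeval ζ q) →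
          (letI : Algebra (LocRing U) ℂ := φ.toAlgebra;
            Module.finrank ℂ (ℂ ⊗[LocRing U] M)) ≠
            Module.finrank (FractionRing (LocRing U))
              (FractionRing (LocRing U) ⊗[LocRing U] M)}.Finite := by
  have hXU : X * U ≠ 0 := mul_ne_zero X_ne_zero hU
  have : IsDomain (LocRing U) :=
    IsLocalization.isDomain_localization (powers_le_nonZeroDivisors_of_noZeroDivisors hXU)
  have : IsNoetherianRing (LocRing U) :=
    IsLocalization.isNoetherianRing (Submonoid.powers (X * U)) _ inferInstance
  obtain ⟨r, hr, hfiber⟩ := exists_finrank_tensorProduct_eq_generic (LocRing U) M ℂ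
  obtain ⟨⟨p, s⟩, hps⟩ := IsLocalization.surj (Submonoid.powers (X * U)) r
  have hp : p ≠ 0 := by
    rintro rfl
    rw [map_zero] at hps
    exact mul_ne_zero hr (IsLocalization.map_units (LocRing U) s).ne_zero hps
  refine (p.rootSet_finite ℂ).subset fun ζ ⟨hζ, hUζ, h⟩ ↦ ?_
  have hunit : IsUnit ((aeval ζ : ℚ[X] →ₐ[ℚ] ℂ).toRingHom (X * U)) := by
    simp [hζ, hUζ]
  let φ : LocRing U →+* ℂ := IsLocalization.Away.lift (X * U) hunit
  have hφ (q : ℚ[X]) : φ (algebraMap ℚ[X] (LocRing U) q) = aeval ζ q :=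
    IsLocalization.Away.lift_eq (X * U) hunit q
  rw [mem_rootSet]
  refine ⟨hp, by_contra fun hpζ ↦ h φ hφ ?_⟩
  let _ : Algebra (LocRing U) ℂ := φ.toAlgebra
  refine hfiber fun (hrζ : φ r = 0) ↦ hpζ ?_
  rw [← hφ, ← hps, map_mul, hrζ, zero_mul]
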